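/- Let A be a J-algebra and a, b ∈ A with a˘;a ≤ 1', b˘;b ≤ 1', 1 = a˘;b, 1 = a;1 = b;1, and (a;a˘)·(b;b˘) ≤ 1'. Define K = a, U = a˘·b˘, P = a;b˘ · b;a˘, R = a;a˘;a˘ · b;a;b˘;a˘ · b;b;b˘, P₀ = a;P;a˘ · b;b˘, and R₀ = a;R;a˘ · b;b˘. Then the submonoid of (A, ;, 1') generated by {P, R, K, U} is equal to the submonoid generated by {P₀, R₀, K, U}. -/

import Mathlib

/-- A J-algebra: an algebra (A, ·, 0, 1, ;, ˘, 1') satisfying Jónsson's axioms. -/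
structure JAlgebra (A : Type*) where
  meet : A → A → A        -- Boolean product ·
  comp : A → A → A        -- relative product ;
  conv : A → A            -- converse ˘
  zero : A                -- 0
  one : A                 -- 1
  ident : A               -- 1'
  massoc : ∀ x y z, meet x (meet y z) = meet (meet x y) z
  mcomm : ∀ x y, meet x y = meet y x
  midem : ∀ x, meet x x = x
  cassoc : ∀ x y z, comp x (comp y z) = comp (comp x y) z
  cid : ∀ x, comp x ident = x
  semidist : ∀ x y z, comp (meet x y) z = meet (comp (meet x y) z) (comp y z)
  convconv : ∀ x, conv (conv x) = x
  convcomp : ∀ x y, conv (comp x y) = comp (conv y) (conv x)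
  convmeet : ∀ x y, conv (meet x y) = meet (conv x) (conv y)
  rot : ∀ x y z, meet (comp x y) z =
    meet (comp (meet (comp z (conv y)) x) (meet y (comp (conv x) z))) z
  zbot : ∀ x, meet zero x = zero
  otop : ∀ x, meet x one = x
  comp_zero : ∀ x, comp x zero = zero

/-- x ≤ y iff x·y = x. -/
def JAlgebra.le {A : Type*} (J : JAlgebra A) (x y : A) : Prop := J.meet x y = x

/-- x is functional iff x˘;x ≤ 1'. -/
def JAlgebra.Functional {A : Type*} (J : JAlgebra A) (x : A) : Prop :=
  J.le (J.comp (J.conv x) x) J.ident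

/-- x is permutational iff x;x˘ = 1' = x˘;x. -/
def JAlgebra.Permutational {A : Type*} (J : JAlgebra A) (x : A) : Prop :=
  J.comp x (J.conv x) = J.ident ∧ J.comp (J.conv x) x = J.ident

/-- Membership in the submonoid of (A, ;, 1') generated by a set S: the
smallest subset of A containing S and 1' and closed under ;. -/
inductive JAlgebra.GenMonoid {A : Type*} (J : JAlgebra A) (S : Set A) : A → Prop
  | mem {x : A} : x ∈ S → JAlgebra.GenMonoid J S x
  | one : JAlgebra.GenMonoid J S J.ident
  | mul {x y : A} : JAlgebra.GenMonoid J S x → JAlgebra.GenMonoid J S y →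
      JAlgebra.GenMonoid J S (J.comp x y)

/-- A monoid with projections and a surjective pairing, composition being written from left to
right. -/
class PairingMonoid (M : Type*) extends Monoid M where
  fst : M
  snd : M
  pair : M → M → M
  pair_fst : ∀ f g, pair f g * fst = f
  pair_snd : ∀ f g, pair f g * snd = g
  mul_pair : ∀ h f g, h * pair f g = pair (h * f) (h * g)
  pair_fst_snd : pair fst snd = 1

namespace PairingMonoid

variable {M : Type*} [PairingMonoid M]

variable (M)

/-- `[x, y] ↦ [y, x]` -/
def swap : M := pair snd fst

/-- `[x, [y, z]] ↦ [[x, y], z]` -/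
def rotate : M := pair (pair fst (snd * fst)) (snd * snd)

/-- `x ↦ [x, x]` -/
def dup : M := pair 1 1

/-- `[[x, y], z] ↦ [x, [y, z]]` -/
def unrotate : M := swap M * rotate M * swap M * rotate M * swap M

/-- `[x, [y, z]] ↦ [x, y]` -/
def dropRight : M := rotate M * fst

/-- `[x, [y, z]] ↦ [x, z]` -/
def dropMiddle : M := rotate M * swap M * rotate M * fst * swap M

variable {M}

theorem pair_fst_mul_swap_snd :
    pair (fst * swap M) snd =
      swap M * dup M * dropMiddle M * dropRight M * unrotate M * swap M * unrotate M *
        unrotate M * swap M * fst * rotate M := by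
  simp only [dropMiddle, dropRight, unrotate, swap, rotate, dup, ← mul_assoc, mul_pair, pair_fst,
    pair_snd, mul_one]

theorem pair_fst_mul_rotate_snd :
    pair (fst * rotate M) snd =
      unrotate M * swap M * dup M * dropRight M * dropRight M * dropRight M * unrotate M *
        unrotate M * unrotate M * swap M * fst * rotate M * swap M * rotate M := by
  simp only [dropRight, unrotate, swap, rotate, dup, ← mul_assoc, mul_pair, pair_fst,
    pair_snd, mul_one]

theorem dup_mul_pair_fst_mul_snd_mul_fst (f : M) : dup M * pair (fst * f) snd * fst = f := by
  rw [mul_assoc, pair_fst, ← mul_assoc, dup, pair_fst, one_mul]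

variable {N : Submonoid M}

theorem unrotate_mem (hs : swap M ∈ N) (hr : rotate M ∈ N) : unrotate M ∈ N := by
  rw [unrotate]
  apply_rules [mul_mem]

theorem dropRight_mem (hr : rotate M ∈ N) (hf : fst ∈ N) : dropRight M ∈ N :=
  mul_mem hr hf

theorem dropMiddle_mem (hs : swap M ∈ N) (hr : rotate M ∈ N) (hf : fst ∈ N) :
    dropMiddle M ∈ N := by
  rw [dropMiddle]
  apply_rules [mul_mem]

theorem pair_fst_mul_swap_snd_mem (hs : swap M ∈ N) (hr : rotate M ∈ N) (hf : fst ∈ N)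
    (hd : dup M ∈ N) : pair (fst * swap M) snd ∈ N := by
  rw [pair_fst_mul_swap_snd]
  have hu := unrotate_mem hs hr
  have hdr := dropRight_mem hr hf
  have hdm := dropMiddle_mem hs hr hf
  repeat' first | assumption | apply mul_mem

theorem pair_fst_mul_rotate_snd_mem (hs : swap M ∈ N) (hr : rotate M ∈ N) (hf : fst ∈ N)
    (hd : dup M ∈ N) : pair (fst * rotate M) snd ∈ N := by
  rw [pair_fst_mul_rotate_snd]
  have hu := unrotate_mem hs hr
  have hdr := dropRight_mem hr hf
  repeat' first | assumption | apply mul_mem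

theorem mem_of_pair_fst_mul_snd_mem {f : M} (h : pair (fst * f) snd ∈ N) (hf : fst ∈ N)
    (hd : dup M ∈ N) : f ∈ N := by
  rw [← dup_mul_pair_fst_mul_snd_mul_fst f]
  exact mul_mem (mul_mem hd h) hf

end PairingMonoid

namespace JAlgebra

variable {A : Type*} {J : JAlgebra A} {x y z w a b f g : A}

theorem le_rfl : J.le x x := J.midem x

theorem le_of_eq (h : x = y) : J.le x y := h ▸ le_rfl

theorem le_trans (h₁ : J.le x y) (h₂ : J.le y z) : J.le x z := by
  unfold le at *
  rw [← h₁, ← J.massoc, h₂]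

theorem le_antisymm (h₁ : J.le x y) (h₂ : J.le y x) : x = y := by
  unfold le at *
  rw [← h₁, J.mcomm, h₂]

theorem le_one : J.le x J.one := J.otop x

theorem meet_le_right : J.le (J.meet x y) y := by
  rw [le, ← J.massoc, J.midem]

theorem meet_le_left : J.le (J.meet x y) x := by
  rw [J.mcomm]
  exact meet_le_right

theorem le_meet (h₁ : J.le x y) (h₂ : J.le x z) : J.le x (J.meet y z) := by
  unfold le at *
  rw [J.massoc, h₁, h₂]

theorem meet_mono_right (h : J.le y z) : J.le (J.meet x y) (J.meet x z) :=
  le_meet meet_le_left (le_trans meet_le_right h)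

theorem comp_mono_left (h : J.le x y) : J.le (J.comp x z) (J.comp y z) := by
  have := J.semidist x y z
  rw [h] at this
  exact this.symm

theorem conv_mono (h : J.le x y) : J.le (J.conv x) (J.conv y) := by
  rw [le, ← J.convmeet, h]

theorem comp_mono_right (h : J.le x y) : J.le (J.comp z x) (J.comp z y) := by
  have := conv_mono (comp_mono_left (z := J.conv z) (conv_mono h))
  simpa only [J.convcomp, J.convconv] using this

theorem comp_mono (h₁ : J.le x y) (h₂ : J.le z w) : J.le (J.comp x z) (J.comp y w) :=
  le_trans (comp_mono_left h₁) (comp_mono_right h₂)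

variable (J) in
theorem conv_ident : J.conv J.ident = J.ident := by
  have h : J.conv (J.comp (J.conv J.ident) J.ident) = J.comp (J.conv J.ident) J.ident := by
    rw [J.convcomp, J.convconv]
  rw [J.cid, J.convconv] at h
  exact h.symm

variable (J) in
theorem ident_comp (x : A) : J.comp J.ident x = x := by
  rw [← J.convconv (J.comp J.ident x), J.convcomp, J.conv_ident, J.cid, J.convconv]

variable (J) in
theorem conv_one : J.conv J.one = J.one := by
  refine le_antisymm le_one ?_
  have := conv_mono (le_one (J := J) (x := J.conv J.one))
  rwa [J.convconv] at this

theorem modular_left :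
    J.le (J.meet (J.comp x y) z) (J.comp (J.meet x (J.comp z (J.conv y))) y) := by
  rw [J.rot, J.mcomm x]
  exact le_trans meet_le_left (comp_mono_right meet_le_left)

theorem modular_right :
    J.le (J.meet (J.comp x y) z) (J.comp x (J.meet y (J.comp (J.conv x) z))) := by
  rw [J.rot]
  exact le_trans meet_le_left (comp_mono_left meet_le_right)

theorem Functional.comp_meet (hf : J.Functional f) :
    J.comp f (J.meet x y) = J.meet (J.comp f x) (J.comp f y) := by
  refine le_antisymm (le_meet (comp_mono_right meet_le_left) (comp_mono_right meet_le_right)) ?_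
  refine le_trans modular_right (comp_mono_right (meet_mono_right ?_))
  rw [J.cassoc]
  exact le_trans (comp_mono_left hf) (le_of_eq (J.ident_comp y))

theorem Functional.meet_comp_conv (hf : J.Functional f) :
    J.comp (J.meet x y) (J.conv f) = J.meet (J.comp x (J.conv f)) (J.comp y (J.conv f)) := by
  rw [← J.convconv (J.comp (J.meet x y) (J.conv f)), J.convcomp, J.convconv, J.convmeet,
    hf.comp_meet, J.convmeet]
  simp only [J.convcomp, J.convconv]

theorem Functional.meet_comp (hf : J.Functional f) :
    J.comp (J.meet x (J.comp y (J.conv f))) f = J.meet (J.comp x f) y := by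
  refine le_antisymm (le_meet (comp_mono_left meet_le_left) ?_) modular_left
  refine le_trans (comp_mono_left meet_le_right) ?_
  rw [← J.cassoc]
  exact le_trans (comp_mono_right hf) (le_of_eq (J.cid y))

theorem conv_comp_comp_le (hf : J.Functional f) :
    J.le (J.comp (J.conv (J.comp f g)) (J.comp f g)) (J.comp (J.conv g) g) := by
  rw [J.convcomp, ← J.cassoc, J.cassoc (J.conv f)]
  exact comp_mono_right (le_trans (comp_mono_left hf) (le_of_eq (J.ident_comp g)))

variable (J) in
/-- `x` is functional with domain everything. -/
def TotalFunctional (x : A) : Prop :=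
  J.Functional x ∧ J.comp x J.one = J.one

theorem TotalFunctional.ident_le (hf : J.TotalFunctional f) :
    J.le J.ident (J.comp f (J.conv f)) := by
  have h := modular_right (J := J) (x := f) (y := J.one) (z := J.ident)
  rw [hf.2, J.cid, J.mcomm, J.otop, J.mcomm J.one, J.otop] at h
  exact h

theorem TotalFunctional.ident : J.TotalFunctional J.ident := by
  refine ⟨?_, J.ident_comp _⟩
  rw [Functional, J.conv_ident, J.cid]
  exact le_rfl

theorem TotalFunctional.comp (hf : J.TotalFunctional f) (hg : J.TotalFunctional g) :
    J.TotalFunctional (J.comp f g) :=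
  ⟨le_trans (conv_comp_comp_le hf.1) hg.1, by rw [← J.cassoc, hg.2, hf.2]⟩

variable (J) in
/-- `a` and `b` are the projections of a surjective pairing. -/
structure IsPairing (a b : A) : Prop where
  fst : J.TotalFunctional a
  snd : J.TotalFunctional b
  quasi : J.comp (J.conv a) b = J.one
  unique : J.le (J.meet (J.comp a (J.conv a)) (J.comp b (J.conv b))) J.ident

variable (J) in
/-- The pairing of `f` and `g` with respect to the projections `a` and `b`. -/
def fork (a b f g : A) : A :=
  J.meet (J.comp f (J.conv a)) (J.comp g (J.conv b))

namespace IsPairing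

variable (h : J.IsPairing a b)
include h

theorem fork_comp_fst (hg : J.TotalFunctional g) : J.comp (J.fork a b f g) a = f := by
  have hq : J.comp (J.conv b) a = J.one := by
    rw [← J.convconv (J.comp (J.conv b) a), J.convcomp, J.convconv, h.quasi, J.conv_one]
  rw [fork, J.mcomm, h.fst.1.meet_comp, ← J.cassoc, hq, hg.2, J.mcomm, J.otop]

theorem fork_comp_snd (hf : J.TotalFunctional f) : J.comp (J.fork a b f g) b = g := by
  rw [fork, h.snd.1.meet_comp, ← J.cassoc, h.quasi, hf.2, J.mcomm, J.otop]

theorem fork_self : J.fork a b a b = J.ident :=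
  le_antisymm h.unique (le_meet h.fst.ident_le h.snd.ident_le)

theorem totalFunctional_fork (hf : J.TotalFunctional f) (hg : J.TotalFunctional g) :
    J.TotalFunctional (J.fork a b f g) := by
  constructor
  · have key {p c k : A} (hk : J.Functional k) (hp : J.le p (J.comp k (J.conv c))) :
        J.le (J.comp (J.conv p) p) (J.comp c (J.conv c)) := by
      refine le_trans (comp_mono (conv_mono hp) hp) (le_trans (conv_comp_comp_le hk) ?_)
      rw [J.convconv]
      exact le_rfl
    exact le_trans (le_meet (key hf.1 meet_le_left) (key hg.1 meet_le_right)) h.unique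
  · rw [← h.fst.2, J.cassoc, h.fork_comp_fst hg, h.fst.2, hf.2]

/-- The total functional elements form a monoid with pairing. -/
abbrev pairingMonoid : PairingMonoid {x // J.TotalFunctional x} where
  mul f g := ⟨J.comp f g, f.2.comp g.2⟩
  one := ⟨J.ident, .ident⟩
  mul_assoc f g k := Subtype.ext (J.cassoc f g k).symm
  one_mul f := Subtype.ext (J.ident_comp f)
  mul_one f := Subtype.ext (J.cid f)
  fst := ⟨a, h.fst⟩
  snd := ⟨b, h.snd⟩
  pair f g := ⟨J.fork a b f g, h.totalFunctional_fork f.2 g.2⟩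
  pair_fst f g := Subtype.ext (h.fork_comp_fst g.2)
  pair_snd f g := Subtype.ext (h.fork_comp_snd f.2)
  mul_pair k f g := Subtype.ext <| by
    change J.comp k (J.meet _ _) = J.meet (J.comp (J.comp _ _) _) (J.comp (J.comp _ _) _)
    rw [k.2.1.comp_meet, J.cassoc, J.cassoc]
  pair_fst_snd := Subtype.ext h.fork_self

end IsPairing

theorem GenMonoid.of_subset {S T : Set A} (h : ∀ s ∈ S, J.GenMonoid T s) (hx : J.GenMonoid S x) :
    J.GenMonoid T x := by
  induction hx with
  | mem hs => exact h _ hs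
  | one => exact .one
  | mul _ _ h₁ h₂ => exact .mul h₁ h₂

end JAlgebra

/-- Under (Q), (D), (U), the sets {P, R, K, U} and {P₀, R₀, K, U} generate the
same submonoid of (A, ;, 1'). -/
theorem same_submonoid {A : Type*} (J : JAlgebra A) (a b : A)
    (ha : J.le (J.comp (J.conv a) a) J.ident)
    (hb : J.le (J.comp (J.conv b) b) J.ident)
    (hQ : J.one = J.comp (J.conv a) b)
    (hDa : J.one = J.comp a J.one)
    (hDb : J.one = J.comp b J.one)
    (hU : J.le (J.meet (J.comp a (J.conv a)) (J.comp b (J.conv b))) J.ident)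
    (K U P R P₀ R₀ : A)
    (hK : K = a)
    (hU' : U = J.meet (J.conv a) (J.conv b))
    (hP : P = J.meet (J.comp a (J.conv b)) (J.comp b (J.conv a)))
    (hR : R = J.meet (J.meet (J.comp (J.comp a (J.conv a)) (J.conv a))
                (J.comp (J.comp (J.comp b a) (J.conv b)) (J.conv a)))
              (J.comp (J.comp b b) (J.conv b)))
    (hP₀ : P₀ = J.meet (J.comp (J.comp a P) (J.conv a)) (J.comp b (J.conv b)))
    (hR₀ : R₀ = J.meet (J.comp (J.comp a R) (J.conv a)) (J.comp b (J.conv b))) :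
    ∀ x : A, J.GenMonoid ({P, R, K, U} : Set A) x ↔
      J.GenMonoid ({P₀, R₀, K, U} : Set A) x := by
  have h : J.IsPairing a b := ⟨⟨ha, hDa.symm⟩, ⟨hb, hDb.symm⟩, hQ.symm, hU⟩
  let := h.pairingMonoid
  let M := {x // J.TotalFunctional x}
  let N (T : Set A) : Submonoid M :=
    { carrier := {m | J.GenMonoid T m}
      one_mem' := .one
      mul_mem' := .mul }
  have hKM : K = (PairingMonoid.fst : M).1 := hK
  have hUM : U = (PairingMonoid.dup M).1 := by
    change U = J.meet (J.comp J.ident _) (J.comp J.ident _)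
    rw [J.ident_comp, J.ident_comp, hU']
  have hPM : P = (PairingMonoid.swap M).1 := by
    change P = J.meet _ _
    rw [hP, J.mcomm]
    rfl
  have hRM : R = (PairingMonoid.rotate M).1 := by
    change R = J.meet (J.comp (J.meet _ (J.comp (J.comp b a) _)) _) (J.comp (J.comp b b) _)
    rw [hR, JAlgebra.Functional.meet_comp_conv ha]
    rfl
  have hP₀M : P₀ = (PairingMonoid.pair (PairingMonoid.fst * PairingMonoid.swap M) PairingMonoid.snd : M).1 := by
    rw [hP₀, hPM]
    rfl
  have hR₀M : R₀ = (PairingMonoid.pair (PairingMonoid.fst * PairingMonoid.rotate M) PairingMonoid.snd : M).1 := by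
    rw [hR₀, hRM]
    rfl
  refine fun x => ⟨.of_subset ?_, .of_subset ?_⟩
  · set T : Set A := {P₀, R₀, K, U} with hT
    have hk : PairingMonoid.fst ∈ N T := .mem (by simp [hT, ← hKM])
    have hu : PairingMonoid.dup M ∈ N T := .mem (by simp [hT, ← hUM])
    have hp : PairingMonoid.swap M ∈ N T :=
      PairingMonoid.mem_of_pair_fst_mul_snd_mem (.mem (by simp [hT, ← hP₀M])) hk hu
    have hr : PairingMonoid.rotate M ∈ N T :=
      PairingMonoid.mem_of_pair_fst_mul_snd_mem (.mem (by simp [hT, ← hR₀M])) hk hu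
    rintro s (rfl | rfl | rfl | rfl)
    exacts [hPM ▸ hp, hRM ▸ hr, hKM ▸ hk, hUM ▸ hu]
  · set T : Set A := {P, R, K, U} with hT
    have hk : PairingMonoid.fst ∈ N T := .mem (by simp [hT, ← hKM])
    have hu : PairingMonoid.dup M ∈ N T := .mem (by simp [hT, ← hUM])
    have hp : PairingMonoid.swap M ∈ N T := .mem (by simp [hT, ← hPM])
    have hr : PairingMonoid.rotate M ∈ N T := .mem (by simp [hT, ← hRM])
    have hp₀ := PairingMonoid.pair_fst_mul_swap_snd_mem hp hr hk hu
    have hr₀ := PairingMonoid.pair_fst_mul_rotate_snd_mem hp hr hk hu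
    rintro s (rfl | rfl | rfl | rfl)
    exacts [hP₀M ▸ hp₀, hR₀M ▸ hr₀, hKM ▸ hk, hUM ▸ hu]
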